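/- arXiv:1007.4152 — 2 statements merged into one kernel-verified Lean document; each statement's English description precedes it below -/
import Mathlib

section
/- Let M₁,…,M_s be m×m real symmetric positive semidefinite matrices and p ∈ (0,1]. Then the set function I ↦ trace((Σ_{i∈I} M_i)^p) on subsets of {1,…,s} is submodular: for all I, J ⊆ {1,…,s}, trace((Σ_{i∈I} M_i)^p) + trace((Σ_{i∈J} M_i)^p) ≥ trace((Σ_{i∈I∪J} M_i)^p) + trace((Σ_{i∈I∩J} M_i)^p). -/
open Matrix in
/-- Applying a real function to a real symmetric matrix via the spectral
decomposition: `f(A) = U Diag(f(λ₁),…,f(λ_m)) Uᵀ`. Junk value `0` on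
non-symmetric input. -/
noncomputable def matFun (f : ℝ → ℝ) {m : ℕ} (A : Matrix (Fin m) (Fin m) ℝ) :
    Matrix (Fin m) (Fin m) ℝ :=
  if hA : A.IsHermitian then
    (hA.eigenvectorUnitary : Matrix (Fin m) (Fin m) ℝ) *
      Matrix.diagonal (fun i => f (hA.eigenvalues i)) *
      star (hA.eigenvectorUnitary : Matrix (Fin m) (Fin m) ℝ)
  else 0

namespace Matrix

variable {n : Type*} [Fintype n] [DecidableEq n]

lemma PosSemidef.exists_eq_conjTranspose_mul_self {A : Matrix n n ℝ} (hA : A.PosSemidef) :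
    ∃ L : Matrix n n ℝ, A = Lᴴ * L := by
  open scoped MatrixOrder Matrix.Norms.L2Operator in
  exact CStarAlgebra.nonneg_iff_eq_star_mul_self.mp hA.nonneg

lemma IsHermitian.det_smul_one_add {A : Matrix n n ℝ} (hA : A.IsHermitian) (t : ℝ) :
    (t • (1 : Matrix n n ℝ) + A).det = ∏ i, (t + hA.eigenvalues i) := by
  have h := congrArg (Polynomial.eval (-t)) hA.charpoly_eq
  rw [eval_charpoly, Polynomial.eval_prod] at h
  have h₁ : scalar n (-t) - A = -(t • (1 : Matrix n n ℝ) + A) := by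
    rw [scalar_apply, ← smul_one_eq_diagonal, neg_smul]
    abel
  have h₂ : ∀ i, -t - hA.eigenvalues i = -1 * (t + hA.eigenvalues i) := fun i => by ring
  simp only [Polynomial.eval_sub, Polynomial.eval_X, Polynomial.eval_C, RCLike.ofReal_real_eq_id,
    id_eq, h₁, det_neg, h₂, Finset.prod_mul_distrib, Finset.prod_const, Finset.card_univ] at h
  exact mul_left_cancel₀ (pow_ne_zero _ (by norm_num)) h

lemma PosSemidef.one_le_det_one_add {A : Matrix n n ℝ} (hA : A.PosSemidef) :
    1 ≤ (1 + A).det := by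
  have h := hA.isHermitian.det_smul_one_add 1
  rw [one_smul] at h
  rw [h]
  exact Finset.one_le_prod fun i => by simpa using hA.eigenvalues_nonneg i

lemma PosDef.det_le_det_add {A B : Matrix n n ℝ} (hA : A.PosDef) (hB : B.PosSemidef) :
    A.det ≤ (A + B).det := by
  obtain ⟨L, rfl⟩ := hB.exists_eq_conjTranspose_mul_self
  rw [det_add_mul _ _ hA.det_pos.ne'.isUnit]
  exact le_mul_of_one_le_right hA.det_pos.le
    (hA.inv.posSemidef.mul_mul_conjTranspose_same L).one_le_det_one_add

lemma PosDef.posSemidef_inv_sub_inv_add {A B : Matrix n n ℝ} (hA : A.PosDef)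
    (hB : B.PosSemidef) : (A⁻¹ - (A + B)⁻¹).PosSemidef := by
  obtain ⟨L, rfl⟩ := hB.exists_eq_conjTranspose_mul_self
  have hS : (1 + L * A⁻¹ * Lᴴ).PosDef :=
    PosDef.one.add_posSemidef (hA.inv.posSemidef.mul_mul_conjTranspose_same L)
  have h₁ : (1 : Matrix n n ℝ)⁻¹ = 1 := inv_eq_right_inv (Matrix.one_mul 1)
  have h := add_mul_mul_inv_eq_sub A Lᴴ 1 L hA.isUnit isUnit_one (by rw [h₁]; exact hS.isUnit)
  rw [Matrix.mul_one, h₁] at h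
  have h' := hS.inv.posSemidef.mul_mul_conjTranspose_same (A⁻¹ * Lᴴ)
  rw [conjTranspose_mul, conjTranspose_conjTranspose, hA.inv.isHermitian.eq,
    ← Matrix.mul_assoc] at h'
  rwa [h, sub_sub_cancel]

lemma PosDef.det_add_add_mul_det_le {A B C : Matrix n n ℝ} (hA : A.PosDef)
    (hB : B.PosSemidef) (hC : C.PosSemidef) :
    (A + B + C).det * A.det ≤ (A + B).det * (A + C).det := by
  obtain ⟨L, rfl⟩ := hC.exists_eq_conjTranspose_mul_self
  have hAB := hA.add_posSemidef hB
  rw [det_add_mul _ _ hA.det_pos.ne'.isUnit, det_add_mul _ _ hAB.det_pos.ne'.isUnit,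
    mul_assoc, mul_comm _ A.det]
  refine mul_le_mul_of_nonneg_left (mul_le_mul_of_nonneg_left ?_ hA.det_pos.le) hAB.det_pos.le
  have h := (PosDef.one.add_posSemidef
    (hAB.inv.posSemidef.mul_mul_conjTranspose_same L)).det_le_det_add
    ((hA.posSemidef_inv_sub_inv_add hB).mul_mul_conjTranspose_same L)
  rwa [Matrix.mul_sub, Matrix.sub_mul, add_add_sub_cancel] at h

end Matrix

open MeasureTheory Set in
lemma integrableOn_rpow_mul_log_one_add_div {p : ℝ} (hp₀ : 0 < p) (hp₁ : p < 1) {x : ℝ}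
    (hx : 0 ≤ x) :
    IntegrableOn (fun t => t ^ (p - 1) * Real.log (1 + x / t)) (Ioi 0) := by
  have hmeas : Measurable fun t : ℝ => t ^ (p - 1) * Real.log (1 + x / t) := by fun_prop
  have hlog : ∀ t : ℝ, 0 < t → 0 ≤ Real.log (1 + x / t) := fun t ht =>
    Real.log_nonneg (le_add_of_nonneg_right (by positivity))
  rw [← Ioc_union_Ioi_eq_Ioi zero_le_one]
  refine IntegrableOn.union ?_ ?_
  · have hint : IntegrableOn (fun t : ℝ => t ^ (p / 2 - 1) * ((1 + x) ^ (p / 2) / (p / 2)))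
        (Ioc 0 1) :=
      ((intervalIntegrable_iff_integrableOn_Ioc_of_le zero_le_one).mp
        (intervalIntegral.intervalIntegrable_rpow' (by linarith))).mul_const _
    refine hint.mono' hmeas.aestronglyMeasurable
      ((ae_restrict_iff' measurableSet_Ioc).mpr (.of_forall fun t ht => ?_))
    obtain ⟨ht₀, ht₁⟩ := ht
    rw [Real.norm_of_nonneg (mul_nonneg (by positivity) (hlog t ht₀))]
    have h₁ : 1 + x / t ≤ (1 + x) / t := by
      rw [add_div]
      gcongr
      exact (one_le_div ht₀).mpr ht₁
    calc t ^ (p - 1) * Real.log (1 + x / t)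
        ≤ t ^ (p - 1) * (((1 + x) / t) ^ (p / 2) / (p / 2)) := by
          gcongr
          exact (Real.log_le_rpow_div (by positivity) (half_pos hp₀)).trans (by gcongr)
      _ = t ^ (p / 2 - 1) * ((1 + x) ^ (p / 2) / (p / 2)) := by
          rw [Real.div_rpow (by positivity) ht₀.le,
            show p - 1 = (p / 2 - 1) + p / 2 by ring, Real.rpow_add ht₀]
          field_simp
  · refine ((integrableOn_Ioi_rpow_of_lt (show p - 2 < -1 by linarith)
      zero_lt_one).mul_const x).mono' hmeas.aestronglyMeasurable
      ((ae_restrict_iff' measurableSet_Ioi).mpr (.of_forall fun t ht => ?_))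
    have ht₀ : 0 < t := zero_lt_one.trans ht
    rw [Real.norm_of_nonneg (mul_nonneg (by positivity) (hlog t ht₀))]
    calc t ^ (p - 1) * Real.log (1 + x / t) ≤ t ^ (p - 1) * (x / t) := by
          gcongr
          linarith [Real.log_le_sub_one_of_pos (show 0 < 1 + x / t by positivity)]
      _ = t ^ (p - 2) * x := by
          rw [show p - 1 = (p - 2) + 1 by ring, Real.rpow_add ht₀, Real.rpow_one]
          field_simp

open MeasureTheory Set in
lemma integral_rpow_mul_log_one_add_div {p : ℝ} (hp : 0 < p) {x : ℝ} (hx : 0 ≤ x) :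
    ∫ t in Ioi (0 : ℝ), t ^ (p - 1) * Real.log (1 + x / t) =
      x ^ p * ∫ t in Ioi (0 : ℝ), t ^ (p - 1) * Real.log (1 + 1 / t) := by
  rcases hx.eq_or_lt with rfl | hx
  · simp [Real.zero_rpow hp.ne']
  have h := integral_comp_mul_left_Ioi' (fun t => t ^ (p - 1) * Real.log (1 + x / t)) 0 hx
  rw [mul_zero] at h
  rw [← h, smul_eq_mul, ← integral_const_mul, ← integral_const_mul]
  refine setIntegral_congr_fun measurableSet_Ioi fun t ht => ?_
  have ht : 0 < t := ht
  have hdiv : x / (x * t) = 1 / t := by field_simp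
  simp only [hdiv, Real.mul_rpow hx.le ht.le, Real.rpow_sub_one hx.ne']
  field_simp

open MeasureTheory Set in
lemma integral_rpow_mul_log_one_add_one_div_pos {p : ℝ} (hp₀ : 0 < p) (hp₁ : p < 1) :
    0 < ∫ t in Ioi (0 : ℝ), t ^ (p - 1) * Real.log (1 + 1 / t) := by
  have hpos : ∀ t ∈ Ioi (0 : ℝ), 0 < t ^ (p - 1) * Real.log (1 + 1 / t) := fun t ht =>
    have ht : 0 < t := ht
    mul_pos (by positivity) (Real.log_pos (lt_add_of_pos_right _ (by positivity)))
  rw [setIntegral_pos_iff_support_of_nonneg_ae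
    ((ae_restrict_iff' measurableSet_Ioi).mpr (.of_forall fun t ht => (hpos t ht).le))
    (integrableOn_rpow_mul_log_one_add_div hp₀ hp₁ zero_le_one),
    inter_eq_right.mpr fun t ht => Function.mem_support.mpr (hpos t ht).ne']
  simp

lemma trace_matFun (f : ℝ → ℝ) {m : ℕ} {A : Matrix (Fin m) (Fin m) ℝ} (hA : A.IsHermitian) :
    (matFun f A).trace = ∑ i, f (hA.eigenvalues i) := by
  rw [matFun, dif_pos hA, Matrix.trace_mul_comm, ← Matrix.mul_assoc]
  simp [Matrix.trace_diagonal]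

lemma sum_log_one_add_eigenvalues_div {n : Type*} [Fintype n] [DecidableEq n]
    {A : Matrix n n ℝ} (hA : A.PosSemidef) {t : ℝ} (ht : 0 < t) :
    ∑ i, Real.log (1 + hA.isHermitian.eigenvalues i / t) =
      Real.log (t • (1 : Matrix n n ℝ) + A).det - Fintype.card n * Real.log t := by
  have hpos : ∀ i, 0 < t + hA.isHermitian.eigenvalues i := fun i =>
    add_pos_of_pos_of_nonneg ht (hA.eigenvalues_nonneg i)
  have h : ∀ i, Real.log (1 + hA.isHermitian.eigenvalues i / t) =
      Real.log (t + hA.isHermitian.eigenvalues i) - Real.log t := fun i => by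
    rw [← Real.log_div (hpos i).ne' ht.ne', add_div, div_self ht.ne']
  simp [h, hA.isHermitian.det_smul_one_add, Real.log_prod fun i _ => (hpos i).ne']

open MeasureTheory Set in
lemma trace_matFun_rpow_mul {p : ℝ} (hp₀ : 0 < p) (hp₁ : p < 1) {m : ℕ}
    {A : Matrix (Fin m) (Fin m) ℝ} (hA : A.PosSemidef) :
    (matFun (fun x => Real.rpow x p) A).trace *
        ∫ t in Ioi (0 : ℝ), t ^ (p - 1) * Real.log (1 + 1 / t) =
      ∫ t in Ioi (0 : ℝ),
        ∑ i, t ^ (p - 1) * Real.log (1 + hA.isHermitian.eigenvalues i / t) := by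
  rw [integral_finsetSum _ fun i _ =>
    integrableOn_rpow_mul_log_one_add_div hp₀ hp₁ (hA.eigenvalues_nonneg i),
    trace_matFun _ hA.isHermitian, Finset.sum_mul]
  exact Finset.sum_congr rfl fun i _ =>
    (integral_rpow_mul_log_one_add_div hp₀ (hA.eigenvalues_nonneg i)).symm

open MeasureTheory Set in
lemma trace_matFun_rpow_add_add_le {p : ℝ} (hp₀ : 0 < p) (hp₁ : p < 1) {m : ℕ}
    {A B C : Matrix (Fin m) (Fin m) ℝ} (hA : A.PosSemidef) (hB : B.PosSemidef)
    (hC : C.PosSemidef) :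
    (matFun (fun x => Real.rpow x p) (A + B + C)).trace +
        (matFun (fun x => Real.rpow x p) A).trace ≤
      (matFun (fun x => Real.rpow x p) (A + B)).trace +
        (matFun (fun x => Real.rpow x p) (A + C)).trace := by
  have hAB := hA.add hB
  have hAC := hA.add hC
  have hABC := hAB.add hC
  have hint {D : Matrix (Fin m) (Fin m) ℝ} (hD : D.PosSemidef) :
      IntegrableOn (fun t : ℝ => ∑ i, t ^ (p - 1) *
        Real.log (1 + hD.isHermitian.eigenvalues i / t)) (Ioi 0) :=
    integrable_finsetSum _ fun i _ =>
      integrableOn_rpow_mul_log_one_add_div hp₀ hp₁ (hD.eigenvalues_nonneg i)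
  refine le_of_mul_le_mul_right ?_ (integral_rpow_mul_log_one_add_one_div_pos hp₀ hp₁)
  rw [add_mul, add_mul, trace_matFun_rpow_mul hp₀ hp₁ hA, trace_matFun_rpow_mul hp₀ hp₁ hAB,
    trace_matFun_rpow_mul hp₀ hp₁ hAC, trace_matFun_rpow_mul hp₀ hp₁ hABC,
    ← integral_add (hint hABC) (hint hA), ← integral_add (hint hAB) (hint hAC)]
  refine setIntegral_mono_on ((hint hABC).add (hint hA)) ((hint hAB).add (hint hAC))
    measurableSet_Ioi fun t ht => ?_
  have ht : 0 < t := ht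
  have hT : (t • (1 : Matrix (Fin m) (Fin m) ℝ)).PosDef := Matrix.PosDef.one.smul ht
  have hTA := hT.add_posSemidef hA
  simp only [← Finset.mul_sum, ← mul_add]
  rw [sum_log_one_add_eigenvalues_div hA ht, sum_log_one_add_eigenvalues_div hAB ht,
    sum_log_one_add_eigenvalues_div hAC ht, sum_log_one_add_eigenvalues_div hABC ht]
  have hdet := hTA.det_add_add_mul_det_le hB hC
  have hlog := Real.log_le_log
    (mul_pos ((hTA.add_posSemidef hB).add_posSemidef hC).det_pos hTA.det_pos) hdet
  rw [Real.log_mul ((hTA.add_posSemidef hB).add_posSemidef hC).det_pos.ne' hTA.det_pos.ne',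
    Real.log_mul (hTA.add_posSemidef hB).det_pos.ne' (hTA.add_posSemidef hC).det_pos.ne'] at hlog
  simp only [add_assoc] at hlog ⊢
  gcongr ?_ * ?_
  linarith

/-- For `p ∈ (0,1]` and positive semidefinite `M₁,…,M_s`,
the set function `I ↦ trace (∑_{i∈I} M_i)^p` is submodular. -/
theorem trace_rpow_sum_submodular (p : ℝ) (hp : p ∈ Set.Ioc (0 : ℝ) 1)
    (m s : ℕ) (M : Fin s → Matrix (Fin m) (Fin m) ℝ)
    (hM : ∀ i, (M i).PosSemidef) (I J : Finset (Fin s)) :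
    (matFun (fun x => Real.rpow x p) (∑ i ∈ I ∪ J, M i)).trace +
        (matFun (fun x => Real.rpow x p) (∑ i ∈ I ∩ J, M i)).trace ≤
      (matFun (fun x => Real.rpow x p) (∑ i ∈ I, M i)).trace +
        (matFun (fun x => Real.rpow x p) (∑ i ∈ J, M i)).trace := by
  obtain ⟨hp₀, hp₁⟩ := hp
  have hsum (K : Finset (Fin s)) : (∑ i ∈ K, M i).PosSemidef :=
    Matrix.posSemidef_sum K fun i _ => hM i
  rcases hp₁.eq_or_lt with rfl | hp₁
  · have htrace (K : Finset (Fin s)) :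
        (matFun (fun x => Real.rpow x 1) (∑ i ∈ K, M i)).trace = ∑ i ∈ K, (M i).trace := by
      rw [trace_matFun _ (hsum K).isHermitian, ← Matrix.trace_sum,
        (hsum K).isHermitian.trace_eq_sum_eigenvalues]
      exact Finset.sum_congr rfl fun i _ => Real.rpow_one _
    simp only [htrace]
    exact Finset.sum_union_inter.le
  have hI : ∑ i ∈ I, M i = ∑ i ∈ I ∩ J, M i + ∑ i ∈ I \ J, M i :=
    (Finset.sum_inter_add_sum_sdiff I J M).symm
  have hJ : ∑ i ∈ J, M i = ∑ i ∈ I ∩ J, M i + ∑ i ∈ J \ I, M i := by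
    rw [Finset.inter_comm]
    exact (Finset.sum_inter_add_sum_sdiff J I M).symm
  have hIJ : ∑ i ∈ I ∪ J, M i = ∑ i ∈ I ∩ J, M i + ∑ i ∈ I \ J, M i + ∑ i ∈ J \ I, M i := by
    rw [← hI, ← Finset.union_sdiff_self_eq_union, Finset.sum_union Finset.disjoint_sdiff]
  rw [hI, hJ, hIJ]
  exact trace_matFun_rpow_add_add_le hp₀ hp₁ (hsum _) (hsum _) (hsum _)
end

section
/- Let p ∈ (0,1), let M₁,…,M_s be m×m real symmetric positive semidefinite matrices with Σ_{i=1}^s M_i positive definite, let N be a positive integer, and let w* ∈ ℝ_{≥0}^s maximize φ_p(w) = trace((Σ_{i=1}^s w_i M_i)^p) over {w ∈ ℝ^s : w ≥ 0, Σ_i w_i ≤ N}. Let n ∈ ℕ^s maximize Σ_{i=1}^s n_i^p (w*_i)^{1−p} over all n ∈ ℕ^s with Σ_i n_i = N (the output of the incremental rounding algorithm). Then φ_p(n) ≥ F · φ_p(w*), where F = (N/s)^{1−p} if (N/s)^{1−p} ≤ 1/(2−p), and F = 1 − (s/N)(1−p)(1/(2−p))^{(2−p)/(1−p)} otherwise.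 -/
/-- `φ_p(S) = trace (∑_{i∈S} M_i)^p` for a subset `S` of `{1,…,s}`. -/
noncomputable def phiSet (p : ℝ) {m s : ℕ} (M : Fin s → Matrix (Fin m) (Fin m) ℝ)
    (S : Finset (Fin s)) : ℝ :=
  (matFun (fun x => Real.rpow x p) (∑ i ∈ S, M i)).trace

/-- `φ_p(w) = trace (∑_{i=1}^s w_i M_i)^p` for a weight vector `w`. -/
noncomputable def phiW (p : ℝ) {m s : ℕ} (M : Fin s → Matrix (Fin m) (Fin m) ℝ)
    (w : Fin s → ℝ) : ℝ :=
  (matFun (fun x => Real.rpow x p) (∑ i, w i • M i)).trace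

/-- Real power with the convention `0 ^ q = 0` (in particular `0 ^ 0 = 0`). -/
noncomputable def cpow (x q : ℝ) : ℝ := if x = 0 then 0 else Real.rpow x q

section
open Matrix Finset Set Filter Topology MeasureTheory

section
variable {n ι : Type*} [Fintype n] [DecidableEq n] [Fintype ι]

theorem Matrix.hasDerivAt_det_of_eq_one {P : ℝ → Matrix n n ℝ} {P' : Matrix n n ℝ} {s : ℝ}
    (hP : ∀ i j, HasDerivAt (fun t => P t i j) (P' i j) s) (h1 : P s = 1) :
    HasDerivAt (fun t => (P t).det) P'.trace s := by
  let f : (n → n → ℝ) → ℝ := fun A => (Matrix.of A).det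
  have hf : Differentiable ℝ f := by
    simp only [f, Matrix.det_apply, Matrix.of_apply]
    fun_prop
  have hF := (hf (fun i j => (1 : Matrix n n ℝ) i j)).hasFDerivAt
  have hline : HasDerivAt (fun t : ℝ => fun i j => (1 : Matrix n n ℝ) i j + t * P' i j)
      (fun i j => P' i j) 0 := by
    rw [hasDerivAt_pi]; intro i
    rw [hasDerivAt_pi]; intro j
    simpa using ((hasDerivAt_id (0 : ℝ)).mul_const (P' i j)).const_add ((1 : Matrix n n ℝ) i j)
  have h2 : HasDerivAt (fun t : ℝ => (1 + t • P').det) P'.trace 0 := by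
    rw [funext fun t : ℝ => Matrix.det_one_add_smul t P']
    have h := (((hasDerivAt_id (0 : ℝ)).const_mul P'.trace).const_add 1).add
      ((Polynomial.hasDerivAt (1 + (Polynomial.X : Polynomial ℝ) •
        P'.map Polynomial.C).det.divX.divX 0).mul ((hasDerivAt_id (0 : ℝ)).pow 2))
    refine (h.congr_deriv (by simp)).congr_of_eventuallyEq (Eventually.of_forall fun t => ?_)
    simp
  have h3 := (HasFDerivAt.comp_hasDerivAt_of_eq (0 : ℝ) hF hline (by ext i j; simp)).unique
    (h2.congr_of_eventuallyEq (Eventually.of_forall fun t => by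
      simp only [Function.comp, f]; congr 1))
  rw [← h3]
  have hPp : HasDerivAt (fun t => fun i j => P t i j) (fun i j => P' i j) s :=
    hasDerivAt_pi.2 fun i => hasDerivAt_pi.2 fun j => hP i j
  exact HasFDerivAt.comp_hasDerivAt_of_eq s hF hPp (by rw [h1])

theorem Matrix.hasDerivAt_log_det {P : ℝ → Matrix n n ℝ} {P' : Matrix n n ℝ} {s : ℝ}
    (hP : ∀ i j, HasDerivAt (fun t => P t i j) (P' i j) s) (hs : 0 < (P s).det) :
    HasDerivAt (fun t => Real.log (P t).det) ((P s)⁻¹ * P').trace s := by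
  have hu : IsUnit (P s).det := hs.ne'.isUnit
  have h := Matrix.hasDerivAt_det_of_eq_one (P := fun t => (P s)⁻¹ * P t) (P' := (P s)⁻¹ * P')
    (s := s) (fun i j => by
      simp only [Matrix.mul_apply]
      exact HasDerivAt.fun_sum fun k _ => (hP k j).const_mul _) (Matrix.nonsing_inv_mul _ hu)
  have h' := (h.const_mul (P s).det).log (by simp [Matrix.nonsing_inv_mul _ hu, hs.ne'])
  have e : ∀ t, (P s).det * ((P s)⁻¹ * P t).det = (P t).det := fun t => by
    rw [Matrix.det_mul, ← mul_assoc, ← Matrix.det_mul, Matrix.mul_nonsing_inv _ hu]; simp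
  simp only [e] at h'
  convert h' using 1
  field_simp

theorem Matrix.PosSemidef.trace_mul_nonneg {A B : Matrix n n ℝ} (hA : A.PosSemidef)
    (hB : B.PosSemidef) : 0 ≤ (A * B).trace := by
  obtain ⟨R, rfl⟩ : ∃ R : Matrix n n ℝ, B = Rᴴ * R := by
    open scoped MatrixOrder in
    exact CStarAlgebra.nonneg_iff_eq_star_mul_self.1 hB.nonneg
  rw [← Matrix.mul_assoc, Matrix.trace_mul_comm, ← Matrix.mul_assoc]
  exact (hA.mul_mul_conjTranspose_same R).trace_nonneg

theorem Matrix.trace_sandwich_nonneg {S A B : Matrix n n ℝ} (hS : S.IsSymm) (hA : A.PosSemidef)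
    (hB : B.PosSemidef) : 0 ≤ (S * A * S * B).trace := by
  have h := hA.mul_mul_conjTranspose_same S
  rw [Matrix.conjTranspose_eq_transpose_of_trivial, hS.eq] at h
  exact h.trace_mul_nonneg hB

theorem Matrix.sum_sq_mul_trace_resolvent_le {N : ι → Matrix n n ℝ} (hN : ∀ i, (N i).PosSemidef)
    {x : ι → ℝ} (hx : ∀ i, 0 ≤ x i) {K : Matrix n n ℝ} (hK : K.IsSymm)
    (hKB : K * (1 + ∑ i, x i • N i) = 1) {D : ι → Matrix n n ℝ} (hD : ∀ i, (D i).IsSymm)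
    (hDA : ∀ i, (1 + x i • ∑ j, N j) * D i = 1) :
    ∑ i, x i ^ 2 * (D i * N i).trace ≤ (K * ∑ i, x i ^ 2 • N i).trace := by
  have hNs : ∀ i, (N i).IsSymm := fun i => (hN i).isHermitian
  have hcross : ∀ A B C : Matrix n n ℝ, A.IsSymm → B.IsSymm → ∀ i,
      (A * C * B * N i).trace = (B * Cᵀ * A * N i).trace := fun A B C hA hB i => by
    rw [← Matrix.trace_transpose]
    simp only [Matrix.transpose_mul, hA.eq, hB.eq, (hNs i).eq]
    rw [Matrix.trace_mul_comm]
    simp only [Matrix.mul_assoc]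
  have h1 : ∀ i, 0 ≤ x i ^ 2 * ((K * K * N i).trace - 2 * (K * D i * N i).trace
      + (D i * D i * N i).trace) := fun i => by
    have h := Matrix.trace_sandwich_nonneg (hK.sub (hD i)) Matrix.PosSemidef.one (hN i)
    have hc := hcross (D i) K 1 (hD i) hK i
    simp only [Matrix.mul_one, Matrix.transpose_one] at h hc
    simp only [Matrix.sub_mul, Matrix.mul_sub, Matrix.trace_sub] at h
    exact mul_nonneg (sq_nonneg _) (by linarith)
  have h2 : ∀ i j, 0 ≤ x i * (x j ^ 2 * (K * N j * K * N i).trace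
      - 2 * x i * x j * (K * N j * D i * N i).trace
      + x i ^ 2 * (D i * N j * D i * N i).trace) := fun i j => by
    have h := Matrix.trace_sandwich_nonneg ((hK.smul (x j)).sub ((hD i).smul (x i))) (hN j) (hN i)
    have hc := hcross (D i) K (N j) (hD i) hK i
    rw [(hNs j).eq] at hc
    simp only [Matrix.sub_mul, Matrix.mul_sub, Matrix.trace_sub, Matrix.smul_mul,
      Matrix.mul_smul, Matrix.trace_smul, smul_eq_mul, hc] at h
    exact mul_nonneg (hx i) (by linarith)
  have h3 : ∀ i, (K * D i * N i).trace + ∑ j, x j * (K * N j * D i * N i).trace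
      = (D i * N i).trace := fun i => by
    calc _ = ((K * (1 + ∑ j, x j • N j)) * D i * N i).trace := by
          simp [Matrix.mul_add, Matrix.add_mul, Matrix.mul_sum, Matrix.sum_mul, Matrix.trace_sum]
      _ = _ := by rw [hKB, Matrix.one_mul]
  have h4 : ∀ i, (D i * D i * N i).trace + x i * ∑ j, (D i * N j * D i * N i).trace
      = (D i * N i).trace := fun i => by
    calc _ = (D i * ((1 + x i • ∑ j, N j) * D i) * N i).trace := by
          simp [Matrix.mul_add, Matrix.add_mul, Matrix.mul_sum, Matrix.sum_mul, Matrix.trace_sum,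
            Matrix.mul_assoc]
      _ = _ := by rw [hDA, Matrix.mul_one]
  have h5 : ∑ i, x i ^ 2 * (K * K * N i).trace
      + ∑ i, ∑ j, x i * x j ^ 2 * (K * N j * K * N i).trace
      = (K * ∑ i, x i ^ 2 • N i).trace := by
    calc _ = (K * (∑ i, x i ^ 2 • N i) * (K * (1 + ∑ i, x i • N i))).trace := by
          rw [Matrix.mul_add, Matrix.mul_add, Matrix.trace_add]
          congr 1
          · rw [Matrix.mul_one, Matrix.trace_mul_comm, ← Matrix.mul_assoc]
            simp [Matrix.mul_sum, Matrix.trace_sum]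
          · simp [Matrix.sum_mul, Matrix.trace_sum, Finset.mul_sum, mul_assoc]
      _ = _ := by rw [hKB, Matrix.mul_one]
  have hs1 := Finset.sum_nonneg fun i (_ : i ∈ Finset.univ) => h1 i
  have hs2 := Finset.sum_nonneg fun i (_ : i ∈ Finset.univ) =>
    Finset.sum_nonneg fun j (_ : j ∈ Finset.univ) => h2 i j
  have key : (∑ i, x i ^ 2 * ((K * K * N i).trace - 2 * (K * D i * N i).trace
        + (D i * D i * N i).trace))
      + ∑ i, ∑ j, x i * (x j ^ 2 * (K * N j * K * N i).trace
        - 2 * x i * x j * (K * N j * D i * N i).trace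
        + x i ^ 2 * (D i * N j * D i * N i).trace)
      = (K * ∑ i, x i ^ 2 • N i).trace - ∑ i, x i ^ 2 * (D i * N i).trace := by
    rw [← h5, ← Finset.sum_add_distrib, ← Finset.sum_add_distrib, ← Finset.sum_sub_distrib]
    refine Finset.sum_congr rfl fun i _ => ?_
    have e : ∑ j, x i * (x j ^ 2 * (K * N j * K * N i).trace
        - 2 * x i * x j * (K * N j * D i * N i).trace
        + x i ^ 2 * (D i * N j * D i * N i).trace)
        = ∑ j, x i * x j ^ 2 * (K * N j * K * N i).trace
          - 2 * x i ^ 2 * ∑ j, x j * (K * N j * D i * N i).trace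
          + x i ^ 3 * ∑ j, (D i * N j * D i * N i).trace := by
      rw [Finset.mul_sum, Finset.mul_sum, ← Finset.sum_sub_distrib, ← Finset.sum_add_distrib]
      exact Finset.sum_congr rfl fun j _ => by ring
    rw [e]
    linear_combination (-2 * x i ^ 2) * h3 i + x i ^ 2 * h4 i
  linarith

theorem Matrix.sum_diag_mul_log_le_log_det {N : ι → Matrix n n ℝ} (hN : ∀ i, (N i).PosSemidef)
    {a : n → ℝ} (hsum : ∑ i, N i = Matrix.diagonal a) {x : ι → ℝ} (hx : ∀ i, 0 ≤ x i) :
    ∑ i, ∑ k, N i k k / a k * Real.log (1 + x i * a k) ≤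
      Real.log (1 + ∑ i, x i • N i).det := by
  have hNd : ∀ i k, 0 ≤ N i k k := fun i k => (hN i).diag_nonneg
  have ha : ∀ k, 0 ≤ a k := fun k => by
    have := congrFun (congrFun hsum k) k
    rw [Matrix.sum_apply, Matrix.diagonal_apply_eq] at this
    rw [← this]
    exact Finset.sum_nonneg fun i _ => hNd i k
  set y : ι → ℝ → ℝ := fun i s => x i / (1 + s * x i) with hy
  have hden : ∀ i {s : ℝ}, 0 ≤ s → 0 < 1 + s * x i := fun i s hs => by
    have := mul_nonneg hs (hx i); linarith
  have hy0 : ∀ i {s : ℝ}, 0 ≤ s → 0 ≤ y i s := fun i s hs => div_nonneg (hx i) (hden i hs).le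
  have hyd : ∀ i {s : ℝ}, 0 ≤ s → HasDerivAt (y i) (-(y i s) ^ 2) s := fun i s hs => by
    have h := (((hasDerivAt_id s).mul_const (x i)).const_add 1).inv (hden i hs).ne'
    refine (h.const_mul (x i)).congr_deriv ?_
    have := (hden i hs).ne'
    change _ = -(x i / (1 + s * x i)) ^ 2
    simp only [id]
    field_simp
  have hyT : ∀ i, Tendsto (y i) atTop (𝓝 0) := fun i => by
    rcases (hx i).eq_or_lt with h | h
    · simp [hy, ← h]
    · exact Tendsto.div_atTop tendsto_const_nhds
        (tendsto_atTop_add_const_left _ _ (tendsto_id.atTop_mul_const h))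
  have hPD : ∀ {s : ℝ}, 0 ≤ s → (1 + ∑ i, y i s • N i).PosDef := fun {s} hs =>
    Matrix.PosDef.one.add_posSemidef
      (Matrix.posSemidef_sum _ fun i _ => (hN i).smul (hy0 i hs))
  set ψ : ℝ → ℝ := fun s => Real.log (1 + ∑ i, y i s • N i).det
    - ∑ i, ∑ k, N i k k / a k * Real.log (1 + y i s * a k) with hψ
  have hlin : ∀ i k {s : ℝ}, 0 ≤ s → 0 < 1 + y i s * a k := fun i k s hs => by
    have := mul_nonneg (hy0 i hs) (ha k); linarith
  have hψd : ∀ {s : ℝ}, 0 ≤ s → HasDerivAt ψ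
      (((1 + ∑ i, y i s • N i)⁻¹ * ∑ i, (-(y i s) ^ 2) • N i).trace
        - ∑ i, ∑ k, N i k k / a k * ((-(y i s) ^ 2 * a k) / (1 + y i s * a k))) s := fun {s} hs => by
    refine HasDerivAt.sub (Matrix.hasDerivAt_log_det (fun k l => ?_) (hPD hs).det_pos) ?_
    · simp only [Matrix.add_apply, Matrix.sum_apply, Matrix.smul_apply, smul_eq_mul]
      exact (HasDerivAt.fun_sum fun i _ => (hyd i hs).mul_const _).const_add _
    · exact HasDerivAt.fun_sum fun i _ => HasDerivAt.fun_sum fun k _ =>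
        ((((hyd i hs).mul_const _).const_add 1).log (hlin i k hs).ne').const_mul _
  have hψn : ∀ {s : ℝ}, 0 ≤ s →
      (((1 + ∑ i, y i s • N i)⁻¹ * ∑ i, (-(y i s) ^ 2) • N i).trace
        - ∑ i, ∑ k, N i k k / a k * ((-(y i s) ^ 2 * a k) / (1 + y i s * a k))) ≤ 0 :=
      fun {s} hs => by
    have hK : ((1 + ∑ i, y i s • N i)⁻¹).IsSymm := (hPD hs).inv.isHermitian
    have hKB : (1 + ∑ i, y i s • N i)⁻¹ * (1 + ∑ i, y i s • N i) = 1 :=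
      Matrix.nonsing_inv_mul _ (hPD hs).det_pos.ne'.isUnit
    have h := Matrix.sum_sq_mul_trace_resolvent_le hN (fun i => hy0 i hs) hK hKB
      (D := fun i => Matrix.diagonal fun k => (1 + y i s * a k)⁻¹)
      (fun i => Matrix.isSymm_diagonal _) (fun i => by
        rw [hsum, ← Matrix.diagonal_one, ← Matrix.diagonal_smul, Matrix.diagonal_add,
          Matrix.diagonal_mul_diagonal]
        congr 1
        ext k
        simp [(hlin i k hs).ne'])
    simp only [Matrix.trace, Matrix.diag_apply, Matrix.diagonal_mul] at h
    have h1 : ∑ i, ∑ k, N i k k / a k * ((y i s ^ 2 * a k) / (1 + y i s * a k)) ≤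
        ∑ i, y i s ^ 2 * ∑ k, (1 + y i s * a k)⁻¹ * N i k k := by
      refine Finset.sum_le_sum fun i _ => ?_
      rw [Finset.mul_sum]
      refine Finset.sum_le_sum fun k _ => ?_
      have hd := hlin i k hs
      rcases (ha k).eq_or_lt with h0 | h0
      · rw [← h0]; simp only [div_zero, zero_mul]
        exact mul_nonneg (sq_nonneg _) (mul_nonneg (inv_nonneg.2 (by simp)) (hNd i k))
      · have := h0.ne'
        apply le_of_eq
        field_simp
    have h2 : ∑ i, ∑ k, N i k k / a k * ((-(y i s) ^ 2 * a k) / (1 + y i s * a k)) =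
        -∑ i, ∑ k, N i k k / a k * ((y i s ^ 2 * a k) / (1 + y i s * a k)) := by
      simp only [← Finset.sum_neg_distrib]
      exact Finset.sum_congr rfl fun i _ => Finset.sum_congr rfl fun k _ => by ring
    simp only [neg_smul, Finset.sum_neg_distrib, Matrix.mul_neg, Matrix.trace_neg]
    rw [h2]
    have h3 := h1.trans h
    simp only [Matrix.trace, Matrix.diag_apply]
    linarith
  have hanti : AntitoneOn ψ (Set.Ici 0) := by
    refine antitoneOn_of_deriv_nonpos (convex_Ici 0)
      (fun s hs => (hψd hs).continuousAt.continuousWithinAt)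
      (fun s hs => ?_) (fun s hs => ?_) <;> rw [interior_Ici] at hs
    · exact (hψd (le_of_lt hs)).differentiableAt.differentiableWithinAt
    · rw [(hψd (le_of_lt hs)).deriv]
      exact hψn (le_of_lt hs)
  have hT : Tendsto ψ atTop (𝓝 0) := by
    have hP : Tendsto (fun s => 1 + ∑ i, y i s • N i) atTop (𝓝 1) := by
      have := (tendsto_finsetSum Finset.univ fun i _ => (hyT i).smul_const (N i)).const_add
        (1 : Matrix n n ℝ)
      simpa using this
    have h1 : Tendsto (fun s => Real.log (1 + ∑ i, y i s • N i).det) atTop (𝓝 0) := by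
      have hc : Continuous fun A : Matrix n n ℝ => A.det := continuous_id.matrix_det
      have := ((hc.tendsto 1).comp hP).log (by simp)
      simpa using this
    have h2 : Tendsto (fun s => ∑ i, ∑ k, N i k k / a k * Real.log (1 + y i s * a k)) atTop
        (𝓝 0) := by
      have := tendsto_finsetSum Finset.univ fun i (_ : i ∈ Finset.univ) =>
        tendsto_finsetSum Finset.univ fun k (_ : k ∈ Finset.univ) =>
        ((((hyT i).mul_const (a k)).const_add 1).log (by simp)).const_mul (N i k k / a k)
      simpa using this
    simpa using h1.sub h2
  have h0 : 0 ≤ ψ 0 := le_of_tendsto' (hT.comp (tendsto_abs_atTop_atTop)) fun s =>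
    hanti Set.self_mem_Ici (abs_nonneg s) (abs_nonneg s)
  simp only [hψ, hy, zero_mul, add_zero, div_one] at h0
  linarith

end

section
theorem integrableOn_rpow_mul_log_one_add {p : ℝ} (hp : p ∈ Set.Ioo (0 : ℝ) 1) :
    IntegrableOn (fun t : ℝ => t ^ (-p - 1) * Real.log (1 + t)) (Set.Ioi 0) := by
  obtain ⟨hp0, hp1⟩ := hp
  have hcont : ContinuousOn (fun t : ℝ => t ^ (-p - 1) * Real.log (1 + t)) (Set.Ioi 0) := by
    intro t ht
    have ht' : (0 : ℝ) < t := ht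
    refine ContinuousAt.continuousWithinAt (ContinuousAt.mul ?_ ?_)
    · exact Real.continuousAt_rpow_const _ _ (Or.inl ht'.ne')
    · exact ContinuousAt.log (by fun_prop) (by positivity)
  rw [← Set.Ioc_union_Ioi_eq_Ioi zero_le_one]
  refine IntegrableOn.union ?_ ?_
  · have h : IntegrableOn (fun t : ℝ => t ^ (-p)) (Set.Ioc 0 1) := by
      rw [← intervalIntegrable_iff_integrableOn_Ioc_of_le zero_le_one]
      exact intervalIntegral.intervalIntegrable_rpow' (by linarith)
    refine Integrable.mono' h ((hcont.mono Set.Ioc_subset_Ioi_self).aestronglyMeasurable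
      measurableSet_Ioc) ?_
    refine (ae_restrict_mem measurableSet_Ioc).mono fun t ht => ?_
    have ht0 : 0 < t := ht.1
    have hl : 0 ≤ Real.log (1 + t) := Real.log_nonneg (by linarith)
    rw [Real.norm_of_nonneg (by positivity)]
    calc t ^ (-p - 1) * Real.log (1 + t) ≤ t ^ (-p - 1) * t := by
          have := Real.log_le_sub_one_of_pos (show 0 < 1 + t by linarith)
          gcongr; linarith
      _ = t ^ (-p) := by
          rw [← Real.rpow_add_one ht0.ne']; congr 1; ring
  · have h : IntegrableOn (fun t : ℝ => (2 ^ (p / 2) / (p / 2)) * t ^ (-p / 2 - 1))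
        (Set.Ioi 1) :=
      (integrableOn_Ioi_rpow_of_lt (by linarith) one_pos).const_mul _
    refine Integrable.mono' h ((hcont.mono (Set.Ioi_subset_Ioi zero_le_one)).aestronglyMeasurable
      measurableSet_Ioi) ?_
    refine (ae_restrict_mem measurableSet_Ioi).mono fun t ht => ?_
    have ht1 : 1 < t := ht
    have ht0 : 0 < t := by linarith
    have hl : 0 ≤ Real.log (1 + t) := Real.log_nonneg (by linarith)
    rw [Real.norm_of_nonneg (by positivity)]
    calc t ^ (-p - 1) * Real.log (1 + t) ≤ t ^ (-p - 1) * ((2 * t) ^ (p / 2) / (p / 2)) := by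
          gcongr
          refine (Real.log_le_rpow_div (by positivity) (show 0 < p / 2 by linarith)).trans ?_
          gcongr; linarith
      _ = (2 ^ (p / 2) / (p / 2)) * (t ^ (-p - 1) * t ^ (p / 2)) := by
          rw [Real.mul_rpow (by norm_num) ht0.le]; ring
      _ = _ := by rw [← Real.rpow_add ht0]; ring_nf

theorem integral_rpow_mul_log_one_add_pos {p : ℝ} (hp : p ∈ Set.Ioo (0 : ℝ) 1) :
    0 < ∫ t in Set.Ioi (0 : ℝ), t ^ (-p - 1) * Real.log (1 + t) := by
  have hpos : ∀ t ∈ Set.Ioi (0 : ℝ), 0 < t ^ (-p - 1) * Real.log (1 + t) := fun t ht =>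
    mul_pos (Real.rpow_pos_of_pos ht _) (Real.log_pos (by simpa using ht))
  rw [setIntegral_pos_iff_support_of_nonneg_ae
    ((ae_restrict_mem measurableSet_Ioi).mono fun t ht => (hpos t ht).le)
    (integrableOn_rpow_mul_log_one_add hp)]
  rw [Set.inter_eq_right.2 fun t ht => Function.mem_support.2 (hpos t ht).ne']
  simp

theorem integrableOn_rpow_mul_log_one_add_mul {p : ℝ} (hp : p ∈ Set.Ioo (0 : ℝ) 1) {b : ℝ}
    (hb : 0 ≤ b) :
    IntegrableOn (fun t : ℝ => t ^ (-p - 1) * Real.log (1 + b * t)) (Set.Ioi 0) := by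
  rcases hb.eq_or_lt with rfl | hb
  · simp
  have h := (integrableOn_Ioi_comp_mul_left_iff
    (fun t : ℝ => t ^ (-p - 1) * Real.log (1 + t)) 0 hb).2
    (by simpa using integrableOn_rpow_mul_log_one_add hp)
  refine IntegrableOn.congr_fun (h.const_mul (b ^ (p + 1))) (fun t ht => ?_) measurableSet_Ioi
  have ht0 : (0 : ℝ) < t := ht
  rw [Real.mul_rpow hb.le ht0.le, ← mul_assoc, ← mul_assoc, ← Real.rpow_add hb]
  simp

theorem integral_rpow_mul_log_one_add_mul {p : ℝ} (hp : p ∈ Set.Ioo (0 : ℝ) 1) {b : ℝ}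
    (hb : 0 ≤ b) :
    ∫ t in Set.Ioi (0 : ℝ), t ^ (-p - 1) * Real.log (1 + b * t) =
      b ^ p * ∫ t in Set.Ioi (0 : ℝ), t ^ (-p - 1) * Real.log (1 + t) := by
  rcases hb.eq_or_lt with rfl | hb
  · simp [Real.zero_rpow hp.1.ne']
  have h := integral_comp_mul_left_Ioi (fun t : ℝ => t ^ (-p - 1) * Real.log (1 + t)) 0 hb
  rw [mul_zero, smul_eq_mul] at h
  have e : b ^ p = b ^ (p + 1) * b⁻¹ := by
    rw [Real.rpow_add_one hb.ne']; field_simp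
  rw [e, mul_assoc, ← h, ← integral_const_mul]
  refine setIntegral_congr_fun measurableSet_Ioi fun t ht => ?_
  have ht0 : (0 : ℝ) < t := ht
  rw [Real.mul_rpow hb.le ht0.le, ← mul_assoc, ← mul_assoc, ← Real.rpow_add hb]
  simp

theorem integrableOn_sum_rpow_mul_log {ι : Type*} {u : Finset ι} {p : ℝ}
    (hp : p ∈ Set.Ioo (0 : ℝ) 1) {c b : ι → ℝ} (hb : ∀ i ∈ u, 0 ≤ b i) :
    IntegrableOn (fun t : ℝ => ∑ i ∈ u, c i * (t ^ (-p - 1) * Real.log (1 + b i * t)))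
      (Set.Ioi 0) :=
  integrable_finsetSum _ fun i hi =>
    (integrableOn_rpow_mul_log_one_add_mul hp (hb i hi)).const_mul _

theorem integral_sum_rpow_mul_log {ι : Type*} {u : Finset ι} {p : ℝ}
    (hp : p ∈ Set.Ioo (0 : ℝ) 1) {c b : ι → ℝ} (hb : ∀ i ∈ u, 0 ≤ b i) :
    ∫ t in Set.Ioi (0 : ℝ), ∑ i ∈ u, c i * (t ^ (-p - 1) * Real.log (1 + b i * t)) =
      (∑ i ∈ u, c i * b i ^ p) * ∫ t in Set.Ioi (0 : ℝ), t ^ (-p - 1) * Real.log (1 + t) := by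
  rw [integral_finsetSum _ fun i hi =>
    (integrableOn_rpow_mul_log_one_add_mul hp (hb i hi)).const_mul _, Finset.sum_mul]
  refine Finset.sum_congr rfl fun i hi => ?_
  rw [integral_const_mul, integral_rpow_mul_log_one_add_mul hp (hb i hi), mul_assoc]

/-- A weighted inequality between the functions `∑ c log (1 + b t)` for all `t > 0` is inherited by
the power sums `∑ c b ^ p`. -/
theorem sum_mul_rpow_le_of_sum_mul_log_le {ι κ : Type*} {u : Finset ι} {v : Finset κ} {p : ℝ}
    (hp : p ∈ Set.Ioo (0 : ℝ) 1) {c b : ι → ℝ} {d e : κ → ℝ} (hb : ∀ i ∈ u, 0 ≤ b i)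
    (he : ∀ j ∈ v, 0 ≤ e j)
    (h : ∀ t : ℝ, 0 < t →
      ∑ i ∈ u, c i * Real.log (1 + b i * t) ≤ ∑ j ∈ v, d j * Real.log (1 + e j * t)) :
    ∑ i ∈ u, c i * b i ^ p ≤ ∑ j ∈ v, d j * e j ^ p := by
  refine le_of_mul_le_mul_right ?_ (integral_rpow_mul_log_one_add_pos hp)
  rw [← integral_sum_rpow_mul_log hp hb, ← integral_sum_rpow_mul_log hp he]
  refine setIntegral_mono_on (integrableOn_sum_rpow_mul_log hp hb)
    (integrableOn_sum_rpow_mul_log hp he) measurableSet_Ioi fun t ht => ?_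
  have := mul_le_mul_of_nonneg_left (h t ht) (Real.rpow_nonneg (le_of_lt ht) (-p - 1))
  simpa only [Finset.mul_sum, mul_left_comm] using this

end

section
variable {n ι : Type*} [Fintype n] [DecidableEq n] [Fintype ι]

theorem Matrix.IsHermitian.star_eigenvectorUnitary_mul_mul {A : Matrix n n ℝ}
    (hA : A.IsHermitian) :
    star (hA.eigenvectorUnitary : Matrix n n ℝ) * A * (hA.eigenvectorUnitary : Matrix n n ℝ) =
      Matrix.diagonal hA.eigenvalues := by
  have h := hA.conjStarAlgAut_star_eigenvectorUnitary
  rw [Unitary.conjStarAlgAut_star_apply] at h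
  exact h

theorem Matrix.det_one_add_smul_conj {U : Matrix n n ℝ} (hU : star U * U = 1) (A : Matrix n n ℝ)
    (t : ℝ) : (1 + t • (star U * A * U)).det = (1 + t • A).det := by
  have h : 1 + t • (star U * A * U) = star U * (1 + t • A) * U := by
    simp [Matrix.mul_add, Matrix.add_mul, hU]
  rw [h, Matrix.det_mul_right_comm, hU, Matrix.one_mul]

theorem Matrix.IsHermitian.det_one_add_smul {A : Matrix n n ℝ} (hA : A.IsHermitian) (t : ℝ) :
    (1 + t • A).det = ∏ l, (1 + hA.eigenvalues l * t) := by
  rw [← Matrix.det_one_add_smul_conj (Unitary.coe_star_mul_self hA.eigenvectorUnitary) A t,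
    hA.star_eigenvectorUnitary_mul_mul, ← Matrix.diagonal_one, ← Matrix.diagonal_smul,
    Matrix.diagonal_add, Matrix.det_diagonal]
  simp [mul_comm]

theorem exists_sum_eq_trace_rpow_and_le {p : ℝ} (hp : p ∈ Set.Ioo (0 : ℝ) 1)
    {N : ι → Matrix n n ℝ} (hN : ∀ i, (N i).PosSemidef) :
    ∃ c : ι → ℝ,
      (∀ hA : (∑ i, N i).IsHermitian, ∑ i, c i = ∑ k, hA.eigenvalues k ^ p) ∧
      ∀ x : ι → ℝ, (∀ i, 0 ≤ x i) → ∀ hB : (∑ i, x i • N i).IsHermitian,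
        ∑ i, x i ^ p * c i ≤ ∑ l, hB.eigenvalues l ^ p := by
  have hAP : (∑ i, N i).PosSemidef := Matrix.posSemidef_sum _ fun i _ => hN i
  have hA := hAP.isHermitian
  set a := hA.eigenvalues with ha
  have ha0 : ∀ k, 0 ≤ a k := hAP.eigenvalues_nonneg
  set U : Matrix n n ℝ := (hA.eigenvectorUnitary : Matrix n n ℝ) with hUdef
  have hU : star U * U = 1 := Unitary.coe_star_mul_self _
  set L : ι → Matrix n n ℝ := fun i => star U * N i * U with hL
  have hLP : ∀ i, (L i).PosSemidef := fun i => (hN i).conjTranspose_mul_mul_same U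
  have hLs : ∀ x : ι → ℝ, ∑ i, x i • L i = star U * (∑ i, x i • N i) * U := fun x => by
    simp [hL, Matrix.mul_sum, Matrix.sum_mul]
  have hLsum : ∑ i, L i = Matrix.diagonal a := by
    rw [ha, ← hA.star_eigenvectorUnitary_mul_mul]
    simpa using hLs 1
  refine ⟨fun i => ∑ k, L i k k / a k * a k ^ p, fun _ => ?_, fun x hx hB => ?_⟩
  · rw [Finset.sum_comm]
    change _ = ∑ k, a k ^ p
    refine Finset.sum_congr rfl fun k _ => ?_
    have hk : ∑ i, L i k k = a k := by
      have := congrFun (congrFun hLsum k) k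
      rwa [Matrix.sum_apply, Matrix.diagonal_apply_eq] at this
    rw [← Finset.sum_mul, ← Finset.sum_div, hk]
    rcases eq_or_ne (a k) 0 with h | h
    · rw [h, Real.zero_rpow hp.1.ne', mul_zero]
    · rw [div_self h, one_mul]
  have hBP : (∑ i, x i • N i).PosSemidef :=
    Matrix.posSemidef_sum _ fun i _ => (hN i).smul (hx i)
  have hb0 : ∀ l, 0 ≤ hB.eigenvalues l := hBP.eigenvalues_nonneg
  have h := sum_mul_rpow_le_of_sum_mul_log_le (u := (Finset.univ : Finset (ι × n)))
    (v := (Finset.univ : Finset n)) hp (c := fun q => L q.1 q.2 q.2 / a q.2)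
    (b := fun q => x q.1 * a q.2) (d := 1) (e := hB.eigenvalues)
    (fun q _ => mul_nonneg (hx _) (ha0 _)) (fun l _ => hb0 l) (fun t ht => by
      have h := Matrix.sum_diag_mul_log_le_log_det hLP hLsum (x := fun i => t * x i)
        (fun i => mul_nonneg ht.le (hx i))
      have e : ∑ i, (t * x i) • L i = t • (star U * (∑ i, x i • N i) * U) := by
        rw [← hLs, Finset.smul_sum]; simp only [mul_smul]
      rw [e, Matrix.det_one_add_smul_conj hU, hB.det_one_add_smul, Real.log_prod fun l _ => by
        have := mul_nonneg (hb0 l) ht.le; linarith] at h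
      simp only [Fintype.sum_prod_type, Pi.one_apply, one_mul]
      refine le_trans (le_of_eq ?_) h
      exact Finset.sum_congr rfl fun i _ => Finset.sum_congr rfl fun k _ => by ring_nf)
  simp only [Fintype.sum_prod_type, Pi.one_apply, one_mul] at h
  refine le_trans (le_of_eq ?_) h
  refine Finset.sum_congr rfl fun i _ => ?_
  rw [Finset.mul_sum]
  refine Finset.sum_congr rfl fun k _ => ?_
  rw [Real.mul_rpow (hx i) (ha0 k)]; ring

end

section
variable {p : ℝ} {m s : ℕ} {M : Fin s → Matrix (Fin m) (Fin m) ℝ}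

theorem phiW_eq_sum_eigenvalues (w : Fin s → ℝ) (hA : (∑ i, w i • M i).IsHermitian) :
    phiW p M w = ∑ l, hA.eigenvalues l ^ p := by
  rw [phiW, matFun, dif_pos hA, Matrix.trace_mul_cycle, Unitary.coe_star_mul_self, Matrix.one_mul,
    Matrix.trace_diagonal]
  rfl

theorem posSemidef_sum_smul (hM : ∀ i, (M i).PosSemidef) {w : Fin s → ℝ} (hw : ∀ i, 0 ≤ w i) :
    (∑ i, w i • M i).PosSemidef :=
  Matrix.posSemidef_sum _ fun i _ => (hM i).smul (hw i)

theorem phiW_nonneg (hM : ∀ i, (M i).PosSemidef) {w : Fin s → ℝ} (hw : ∀ i, 0 ≤ w i) :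
    0 ≤ phiW p M w := by
  have h := posSemidef_sum_smul hM hw
  rw [phiW_eq_sum_eigenvalues w h.isHermitian]
  exact Finset.sum_nonneg fun l _ => Real.rpow_nonneg (h.eigenvalues_nonneg l) _

/-- A tangent inequality for `φ_p` at `w`; for `∑ w i • M i` invertible, the coefficients are
`c i = w i * trace ((∑ w i • M i) ^ (p - 1) * M i)`. -/
theorem exists_phiW_tangent (hp : p ∈ Set.Ioo (0 : ℝ) 1) (hM : ∀ i, (M i).PosSemidef)
    {w : Fin s → ℝ} (hw : ∀ i, 0 ≤ w i) :
    ∃ c : Fin s → ℝ, ∑ i, c i = phiW p M w ∧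
      ∀ x : Fin s → ℝ, (∀ i, 0 ≤ x i) → ∑ i, x i ^ p * c i ≤ phiW p M (fun i => x i * w i) := by
  obtain ⟨c, hc, hcx⟩ := exists_sum_eq_trace_rpow_and_le hp (N := fun i => w i • M i)
    fun i => (hM i).smul (hw i)
  refine ⟨c, ?_, fun x hx => ?_⟩
  · have h := (posSemidef_sum_smul hM hw).isHermitian
    rw [phiW_eq_sum_eigenvalues w h, hc h]
  · have h := (posSemidef_sum_smul hM fun i => mul_nonneg (hx i) (hw i)).isHermitian
    rw [phiW_eq_sum_eigenvalues _ h]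
    have := hcx x hx
    simp only [smul_smul] at this
    exact this h

theorem one_sub_one_sub_rpow_le {p ε : ℝ} (hp0 : 0 < p) (hp1 : p < 1) (hε0 : 0 < ε) (hε1 : ε < 1) :
    (1 - (1 - ε) ^ p) * (1 - (1 - p) * ε) ≤ p * ε := by
  have h1 : 0 < 1 - ε := by linarith
  have hpos := Real.rpow_pos_of_pos h1 p
  have h := rpow_one_add_le_one_add_mul_self (s := ε / (1 - ε))
    (by linarith [div_nonneg hε0.le h1.le]) hp0.le hp1.le
  have e : 1 + ε / (1 - ε) = (1 - ε)⁻¹ := by field_simp; ring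
  rw [e, Real.inv_rpow h1.le, inv_le_iff_one_le_mul₀ hpos] at h
  have h2 : 1 - ε ≤ (1 - ε) * ((1 + p * (ε / (1 - ε))) * (1 - ε) ^ p) := by nlinarith
  have e2 : (1 - ε) * ((1 + p * (ε / (1 - ε))) * (1 - ε) ^ p)
      = (1 - ε + p * ε) * (1 - ε) ^ p := by field_simp
  rw [e2] at h2
  nlinarith

/-- The coefficients of the tangent inequality at a maximizer are at least proportional to the
weights. -/
theorem mul_le_tangent_coeff (hp : p ∈ Set.Ioo (0 : ℝ) 1) {B : ℝ} (hB : 0 < B) {w c : Fin s → ℝ}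
    (hw0 : ∀ i, 0 ≤ w i) (hwB : ∑ i, w i ≤ B)
    (hopt : ∀ v : Fin s → ℝ, (∀ i, 0 ≤ v i) → (∑ i, v i ≤ B) → phiW p M v ≤ phiW p M w)
    (hφ : 0 ≤ phiW p M w) (hc : ∑ i, c i = phiW p M w)
    (hcx : ∀ x : Fin s → ℝ, (∀ i, 0 ≤ x i) →
      ∑ i, x i ^ p * c i ≤ phiW p M (fun i => x i * w i))
    {i : Fin s} (hi : 0 < w i) : phiW p M w * (w i / B) ≤ c i := by
  obtain ⟨hp0, hp1⟩ := hp
  have hwi : w i ≤ B :=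
    (Finset.single_le_sum (fun j _ => hw0 j) (Finset.mem_univ i)).trans hwB
  set r := w i / B with hr
  have hr0 : 0 < r := div_pos hi hB
  have hr1 : r ≤ 1 := (div_le_one hB).2 hwi
  have hstep : ∀ {ε : ℝ}, 0 < ε → ε < 1 →
      phiW p M w * (p * ε * r) ≤ (1 - (1 - ε) ^ p) * c i := fun {ε} hε0 hε1 => by
    have hden : 0 < 1 - ε * r := by nlinarith
    have hx0 : ∀ j, 0 ≤ (1 - ε * r)⁻¹ * (if j = i then 1 - ε else 1) := fun j => by
      refine mul_nonneg (inv_nonneg.2 hden.le) ?_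
      split_ifs <;> linarith
    have h1 := hcx _ hx0
    have h2 := h1.trans (hopt _ (fun j => mul_nonneg (hx0 j) (hw0 j)) (by
      have e : ∑ j, (1 - ε * r)⁻¹ * (if j = i then 1 - ε else 1) * w j
          = (1 - ε * r)⁻¹ * (∑ j, w j - ε * w i) := by
        simp only [mul_assoc, ← Finset.mul_sum]
        congr 1
        have : ∀ j, (if j = i then 1 - ε else 1) * w j = w j - if j = i then ε * w i else 0 := by
          intro j; split_ifs with h
          · rw [h]; ring
          · ring
        simp [this]
      rw [e, inv_mul_le_iff₀ hden, sub_mul, mul_assoc, hr, div_mul_cancel₀ _ hB.ne']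
      linarith))
    have e2 : ∑ j, ((1 - ε * r)⁻¹ * (if j = i then 1 - ε else 1)) ^ p * c j
        = ((1 - ε * r) ^ p)⁻¹ * (phiW p M w - (1 - (1 - ε) ^ p) * c i) := by
      have : ∀ j, ((1 - ε * r)⁻¹ * (if j = i then 1 - ε else 1)) ^ p * c j
          = ((1 - ε * r) ^ p)⁻¹ * (c j - if j = i then (1 - (1 - ε) ^ p) * c i else 0) := by
        intro j
        rw [Real.mul_rpow (inv_nonneg.2 hden.le) (by split_ifs <;> linarith),
          Real.inv_rpow hden.le]
        split_ifs with h
        · rw [h]; ring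
        · rw [Real.one_rpow]; ring
      rw [Finset.sum_congr rfl fun j _ => this j, ← Finset.mul_sum, Finset.sum_sub_distrib, hc]
      simp
    rw [e2, inv_mul_le_iff₀ (Real.rpow_pos_of_pos hden p)] at h2
    have h3 := rpow_one_add_le_one_add_mul_self (s := -(ε * r)) (by linarith) hp0.le hp1.le
    rw [← sub_eq_add_neg] at h3
    nlinarith [mul_le_mul_of_nonneg_left h3 hφ]
  have hc0 : 0 ≤ c i := by
    have h := hstep (ε := 1 / 2) (by norm_num) (by norm_num)
    have h1 : (1 - 1 / 2 : ℝ) ^ p < 1 := Real.rpow_lt_one (by norm_num) (by norm_num) hp0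
    have h2 : 0 ≤ phiW p M w * (p * (1 / 2) * r) := by positivity
    by_contra! hneg
    nlinarith
  have hfin : ∀ {ε : ℝ}, 0 < ε → ε < 1 →
      phiW p M w * r * (1 - (1 - p) * ε) ≤ c i := fun {ε} hε0 hε1 => by
    have h1 := one_sub_one_sub_rpow_le hp0 hp1 hε0 hε1
    have h2 := hstep hε0 hε1
    have h3 : 0 ≤ 1 - (1 - p) * ε := by nlinarith
    have h4 : (p * ε) * (phiW p M w * r * (1 - (1 - p) * ε)) ≤ (p * ε) * c i :=
      calc _ = phiW p M w * (p * ε * r) * (1 - (1 - p) * ε) := by ring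
        _ ≤ (1 - (1 - ε) ^ p) * c i * (1 - (1 - p) * ε) := by gcongr
        _ = (1 - (1 - ε) ^ p) * (1 - (1 - p) * ε) * c i := by ring
        _ ≤ _ := by gcongr
    exact le_of_mul_le_mul_left h4 (mul_pos hp0 hε0)
  have hT : Tendsto (fun ε : ℝ => phiW p M w * r * (1 - (1 - p) * ε)) (𝓝[>] 0)
      (𝓝 (phiW p M w * r)) := by
    have : Continuous fun ε : ℝ => phiW p M w * r * (1 - (1 - p) * ε) := by fun_prop
    simpa using (this.tendsto 0).mono_left nhdsWithin_le_nhds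
  refine le_of_tendsto hT ?_
  filter_upwards [Ioo_mem_nhdsGT (zero_lt_one' ℝ)] with ε hε using hfin hε.1 hε.2

/-- A maximizer of `∑ n i ^ p * b i` puts no mass where `b` vanishes, unless `b = 0`. -/
theorem eq_zero_of_isMax_sum_rpow {ι : Type*} [Fintype ι] {p : ℝ} (hp0 : 0 < p) {b : ι → ℝ}
    (hb : ∀ i, 0 ≤ b i) {j : ι} (hj : 0 < b j) {n : ι → ℕ}
    (hmax : ∀ n' : ι → ℕ, ∑ i, n' i = ∑ i, n i →
      ∑ i, (n' i : ℝ) ^ p * b i ≤ ∑ i, (n i : ℝ) ^ p * b i)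
    {i : ι} (hi : b i = 0) : n i = 0 := by
  classical
  by_contra hne
  have hji : j ≠ i := fun h => hj.ne' (h ▸ hi)
  set n' : ι → ℕ := fun k => if k = i then 0 else if k = j then n j + n i else n k with hn'
  have hsum : ∑ k, n' k = ∑ k, n k := by
    have h : ∑ k, (n' k + if k = i then n i else 0) = ∑ k, (n k + if k = j then n i else 0) := by
      refine Finset.sum_congr rfl fun k _ => ?_
      simp only [hn']
      split_ifs <;> simp_all
    simp only [Finset.sum_add_distrib, Finset.sum_ite_eq', Finset.mem_univ, if_true] at h
    omega
  refine (hmax n' hsum).not_gt (Finset.sum_lt_sum (fun k _ => ?_) ⟨j, Finset.mem_univ j, ?_⟩)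
  · by_cases hk : k = i
    · rw [hk, hi]; simp
    · refine mul_le_mul_of_nonneg_right (Real.rpow_le_rpow (Nat.cast_nonneg _) ?_ hp0.le) (hb k)
      simp only [hn', if_neg hk]
      split_ifs with h
      · rw [h]; exact_mod_cast Nat.le_add_right _ _
      · exact le_rfl
  · refine mul_lt_mul_of_pos_right (Real.rpow_lt_rpow (Nat.cast_nonneg _) ?_ hp0) hj
    simp only [hn', if_neg hji, if_true]
    exact_mod_cast Nat.lt_add_of_pos_right (Nat.pos_of_ne_zero hne)

end

theorem exists_card_eq_sum_mul_le {ι : Type*} [Fintype ι] {f v : ι → ℝ} {R : ℕ}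
    (hf0 : ∀ i, 0 ≤ f i) (hf1 : ∀ i, f i ≤ 1) (hR : ∑ i, f i = R) :
    ∃ S : Finset ι, S.card = R ∧ ∑ i, f i * v i ≤ ∑ i ∈ S, v i := by
  classical
  have hRc : R ≤ Fintype.card ι := by
    have : (R : ℝ) ≤ Fintype.card ι := by
      rw [← hR]; simpa using Finset.sum_le_sum fun i (_ : i ∈ Finset.univ) => hf1 i
    exact_mod_cast this
  obtain ⟨S, hS, hmax⟩ := Finset.exists_max_image (Finset.powersetCard R (Finset.univ : Finset ι))
    (fun S => ∑ i ∈ S, v i) (Finset.powersetCard_nonempty.2 hRc)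
  have hcard : S.card = R := (Finset.mem_powersetCard.1 hS).2
  refine ⟨S, hcard, ?_⟩
  rcases S.eq_empty_or_nonempty with rfl | hne
  · have h0 : ∑ i, f i = 0 := by rw [hR, ← hcard]; simp
    rw [Finset.sum_eq_zero_iff_of_nonneg fun i _ => hf0 i] at h0
    rw [Finset.sum_eq_zero fun i hi => by rw [h0 i hi, zero_mul]]
    simp
  obtain ⟨i₀, hi₀, hmin⟩ := Finset.exists_min_image S v hne
  have hout : ∀ j ∉ S, v j ≤ v i₀ := fun j hj => by
    have hj' : j ∉ S.erase i₀ := fun h => hj (Finset.mem_of_mem_erase h)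
    have h := hmax (insert j (S.erase i₀)) (Finset.mem_powersetCard.2 ⟨Finset.subset_univ _, by
      rw [Finset.card_insert_of_notMem hj', Finset.card_erase_add_one hi₀, hcard]⟩)
    rw [Finset.sum_insert hj', ← Finset.add_sum_erase S v hi₀] at h
    linarith
  have hsum : ∑ i, (f i - if i ∈ S then 1 else 0) * v i
      ≤ ∑ i, (f i - if i ∈ S then 1 else 0) * v i₀ := by
    refine Finset.sum_le_sum fun i _ => ?_
    split_ifs with hi
    · nlinarith [hmin i hi, hf1 i]
    · nlinarith [hout i hi, hf0 i]
  have hz : ∑ i, (f i - if i ∈ S then (1 : ℝ) else 0) = 0 := by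
    rw [Finset.sum_sub_distrib, hR]; simp [hcard]
  rw [← Finset.sum_mul, hz, zero_mul] at hsum
  simp only [sub_mul, ite_mul, one_mul, zero_mul, Finset.sum_sub_distrib, Finset.sum_ite_mem,
    Finset.univ_inter] at hsum
  linarith

theorem rpow_tangent_le {q a f : ℝ} (hq : 1 ≤ q) (ha : 0 < a) (hf : 0 ≤ f) :
    a ^ q + q * a ^ (q - 1) * (f - a) ≤ f ^ q := by
  have h := one_add_mul_self_le_rpow_one_add (s := f / a - 1)
    (by linarith [div_nonneg hf ha.le]) hq
  have haq := Real.rpow_pos_of_pos ha q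
  rw [add_sub_cancel, Real.div_rpow hf ha.le, le_div_iff₀ haq] at h
  rw [Real.rpow_sub_one ha.ne']
  refine le_trans (le_of_eq ?_) h
  field_simp

theorem rpow_mul_rpow_superadditive {p a b c d : ℝ} (hp : p ∈ Set.Ioo (0 : ℝ) 1) (ha : 0 ≤ a)
    (hb : 0 ≤ b) (hc : 0 ≤ c) (hd : 0 ≤ d) (hac : 0 < a + c) (hbd : 0 < b + d) :
    a ^ p * b ^ (1 - p) + c ^ p * d ^ (1 - p) ≤ (a + c) ^ p * (b + d) ^ (1 - p) := by
  have h1 := Real.geom_mean_le_arith_mean2_weighted hp.1.le (sub_nonneg.2 hp.2.le)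
    (div_nonneg ha hac.le) (div_nonneg hb hbd.le) (by ring)
  have h2 := Real.geom_mean_le_arith_mean2_weighted hp.1.le (sub_nonneg.2 hp.2.le)
    (div_nonneg hc hac.le) (div_nonneg hd hbd.le) (by ring)
  have e : p * (a / (a + c)) + (1 - p) * (b / (b + d))
      + (p * (c / (a + c)) + (1 - p) * (d / (b + d))) = 1 := by field_simp; ring
  have hpos : 0 < (a + c) ^ p * (b + d) ^ (1 - p) := by positivity
  rw [Real.div_rpow ha hac.le, Real.div_rpow hb hbd.le, div_mul_div_comm] at h1
  rw [Real.div_rpow hc hac.le, Real.div_rpow hd hbd.le, div_mul_div_comm] at h2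
  rw [← div_le_one hpos, add_div]
  linarith

theorem rpow_mul_rpow_one_sub {p x : ℝ} (hx : 0 ≤ x) (hp : p ∈ Set.Ioo (0 : ℝ) 1) :
    x ^ p * x ^ (1 - p) = x := by
  rw [← Real.rpow_add_of_nonneg hx hp.1.le (sub_nonneg.2 hp.2.le)]; simp

/-- Rounding some of the entries of `w` up and the others down loses at most the fractional
defects `f - f ^ (2 - p)`. -/
theorem exists_rounding {ι : Type*} [Fintype ι] {p : ℝ} (hp : p ∈ Set.Ioo (0 : ℝ) 1) {N : ℕ}
    {w : ι → ℝ} (hw : ∀ i, 0 ≤ w i) (hwN : ∑ i, w i = N) :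
    ∃ n : ι → ℕ, ∑ i, n i = N ∧
      ∑ i, ((⌊w i⌋₊ : ℝ) + (w i - ⌊w i⌋₊) ^ (2 - p)) ≤ ∑ i, (n i : ℝ) ^ p * w i ^ (1 - p) := by
  classical
  set k : ι → ℕ := fun i => ⌊w i⌋₊ with hk
  set f : ι → ℝ := fun i => w i - k i with hf
  have hf0 : ∀ i, 0 ≤ f i := fun i => sub_nonneg.2 (Nat.floor_le (hw i))
  have hf1 : ∀ i, f i ≤ 1 := fun i => by
    have := Nat.lt_floor_add_one (w i)
    simp only [hf, hk]; linarith
  have hsf : ∑ i, f i = N - ∑ i, (k i : ℝ) := by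
    simp only [hf, Finset.sum_sub_distrib, hwN]
  have hkN : ∑ i, k i ≤ N := by
    have : ∑ i, (k i : ℝ) ≤ N := by
      have := Finset.sum_nonneg fun i (_ : i ∈ Finset.univ) => hf0 i
      linarith
    exact_mod_cast this
  obtain ⟨S, hS, hSv⟩ := exists_card_eq_sum_mul_le (v := fun i => f i ^ (1 - p)) hf0 hf1
    (R := N - ∑ i, k i) (by rw [hsf, Nat.cast_sub hkN]; push_cast; rfl)
  refine ⟨fun i => k i + if i ∈ S then 1 else 0, ?_, ?_⟩
  · rw [Finset.sum_add_distrib]; simp [hS]; omega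
  calc ∑ i, ((k i : ℝ) + f i ^ (2 - p)) = ∑ i, (k i : ℝ) + ∑ i, f i * f i ^ (1 - p) := by
        rw [← Finset.sum_add_distrib]
        refine Finset.sum_congr rfl fun i _ => ?_
        rw [show 2 - p = 1 + (1 - p) by ring,
          Real.rpow_add_of_nonneg (hf0 i) zero_le_one (sub_nonneg.2 hp.2.le), Real.rpow_one]
    _ ≤ ∑ i, (k i : ℝ) + ∑ i ∈ S, f i ^ (1 - p) := by gcongr
    _ = ∑ i, ((k i : ℝ) + if i ∈ S then f i ^ (1 - p) else 0) := by
        rw [Finset.sum_add_distrib, Finset.sum_ite_mem, Finset.univ_inter]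
    _ ≤ _ := by
        refine Finset.sum_le_sum fun i _ => ?_
        have hwi : w i = k i + f i := by simp [hf]
        have hk0 : (0 : ℝ) ≤ k i := Nat.cast_nonneg _
        dsimp only
        split_ifs with hi
        · rcases hk0.eq_or_lt with h0 | h0
          · rw [hwi, Nat.cast_add, ← h0]; simp
          · have := rpow_mul_rpow_superadditive hp hk0 hk0 zero_le_one (hf0 i) (by linarith)
              (add_pos_of_pos_of_nonneg h0 (hf0 i))
            rw [rpow_mul_rpow_one_sub hk0 hp, Real.one_rpow, one_mul] at this
            rw [hwi]; exact_mod_cast this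
        · rw [add_zero, add_zero]
          conv_lhs => rw [← rpow_mul_rpow_one_sub hk0 hp]
          gcongr
          · linarith [hp.2]
          · linarith [hf0 i]

theorem exists_rounding_of_le {ι : Type*} [Fintype ι] {p : ℝ} (hp : p ∈ Set.Ioo (0 : ℝ) 1) {N : ℕ}
    (hN : 0 < N) {w : ι → ℝ} (hw : ∀ i, 0 ≤ w i) (hwN : ∑ i, w i = N) :
    ∃ n : ι → ℕ, ∑ i, n i = N ∧
      (if ((N : ℝ) / Fintype.card ι) ^ (1 - p) ≤ 1 / (2 - p)
        then ((N : ℝ) / Fintype.card ι) ^ (1 - p)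
        else 1 - ((Fintype.card ι : ℝ) / N) * (1 - p) *
          (1 / (2 - p)) ^ ((2 - p) / (1 - p))) * N ≤ ∑ i, (n i : ℝ) ^ p * w i ^ (1 - p) := by
  obtain ⟨n, hn, hle⟩ := exists_rounding hp hw hwN
  refine ⟨n, hn, le_trans ?_ hle⟩
  obtain ⟨hp0, hp1⟩ := hp
  have hN' : (0 : ℝ) < N := by exact_mod_cast hN
  have hs : (0 : ℝ) < Fintype.card ι := by
    rcases isEmpty_or_nonempty ι with h | h
    · simp only [Finset.univ_eq_empty, Finset.sum_empty] at hwN; linarith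
    · exact_mod_cast Fintype.card_pos
  have hfl : ∀ i, (⌊w i⌋₊ : ℝ) ≤ w i := fun i => Nat.floor_le (hw i)
  have htan : ∀ {a : ℝ}, 0 < a → ∀ i,
      a ^ (2 - p) + (2 - p) * a ^ (1 - p) * (w i - ⌊w i⌋₊ - a) ≤ (w i - ⌊w i⌋₊) ^ (2 - p) :=
    fun {a} ha i => by
      have := rpow_tangent_le (q := 2 - p) (by linarith) ha (sub_nonneg.2 (hfl i))
      rwa [show 2 - p - 1 = 1 - p by ring] at this
  have hsplit : ∀ {a : ℝ}, 0 < a → a ^ (2 - p) = a * a ^ (1 - p) := fun {a} ha => by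
    rw [mul_comm, ← Real.rpow_add_one ha.ne']; ring_nf
  have h2p : 0 < 2 - p := by linarith
  split_ifs with hc
  · set a : ℝ := (N : ℝ) / Fintype.card ι with ha
    have ha0 : 0 < a := div_pos hN' hs
    have hσ : (2 - p) * a ^ (1 - p) ≤ 1 := by
      rw [le_div_iff₀ h2p] at hc; linarith
    have hsa : (Fintype.card ι : ℝ) * a = N := by rw [ha]; field_simp
    calc a ^ (1 - p) * N = ∑ i, (a ^ (2 - p) + (2 - p) * a ^ (1 - p) * (w i - a)) := by
          rw [Finset.sum_add_distrib, ← Finset.mul_sum, Finset.sum_sub_distrib, hwN]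
          simp only [Finset.sum_const, Finset.card_univ, nsmul_eq_mul, hsa, sub_self, mul_zero]
          rw [hsplit ha0, ← hsa]; ring
      _ ≤ _ := by
          refine Finset.sum_le_sum fun i _ => ?_
          have h1 := htan ha0 i
          have h2 : (0 : ℝ) ≤ ⌊w i⌋₊ := Nat.cast_nonneg _
          nlinarith
  · set a : ℝ := (1 / (2 - p)) ^ (1 / (1 - p)) with ha
    have ha0 : 0 < a := by positivity
    have hap : a ^ (1 - p) = 1 / (2 - p) := by
      rw [ha, ← Real.rpow_mul (by positivity), one_div_mul_cancel (by linarith), Real.rpow_one]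
    have hδ : (1 - p) * (1 / (2 - p)) ^ ((2 - p) / (1 - p)) = a - a ^ (2 - p) := by
      have e : (2 - p) / (1 - p) = 1 / (1 - p) + 1 := by
        have : 1 - p ≠ 0 := by linarith
        field_simp; ring
      rw [e, Real.rpow_add_one (by positivity), ← ha, hsplit ha0, hap]
      field_simp; ring
    calc _ = ∑ i, (w i - (a - a ^ (2 - p))) := by
          rw [Finset.sum_sub_distrib, hwN, ← hδ]
          simp only [Finset.sum_const, Finset.card_univ, nsmul_eq_mul]
          field_simp
      _ ≤ _ := by
          refine Finset.sum_le_sum fun i _ => ?_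
          have h1 := htan ha0 i
          rw [hap, mul_one_div_cancel h2p.ne'] at h1
          linarith

end

/-- Prior approximation bound for the `N`-replicated design
produced by the incremental rounding algorithm, i.e. any `n ∈ ℕ^s` with
`∑ n_i = N` maximizing `∑_i n_i^p (w*_i)^{1-p}`: one has
`φ_p(n) ≥ F · φ_p(w*)`, where `F = (N/s)^{1-p}` if `(N/s)^{1-p} ≤ 1/(2-p)` and
`F = 1 - (s/N)(1-p)(1/(2-p))^{(2-p)/(1-p)}` otherwise. -/
theorem prior_bound_incremental_rounding (p : ℝ) (hp : p ∈ Set.Ioo (0 : ℝ) 1)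
    (m s : ℕ) (M : Fin s → Matrix (Fin m) (Fin m) ℝ)
    (hM : ∀ i, (M i).PosSemidef) (hsum : (∑ i, M i).PosDef)
    (N : ℕ) (hN : 0 < N)
    (w : Fin s → ℝ) (hw0 : ∀ i, 0 ≤ w i) (hwN : ∑ i, w i ≤ N)
    (hopt : ∀ v : Fin s → ℝ, (∀ i, 0 ≤ v i) → (∑ i, v i ≤ N) →
      phiW p M v ≤ phiW p M w)
    (n : Fin s → ℕ) (hn : ∑ i, n i = N)
    (hnopt : ∀ n' : Fin s → ℕ, (∑ i, n' i = N) →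
      ∑ i, Real.rpow (n' i : ℝ) p * cpow (w i) (1 - p) ≤
        ∑ i, Real.rpow (n i : ℝ) p * cpow (w i) (1 - p)) :
    (if Real.rpow ((N : ℝ) / s) (1 - p) ≤ 1 / (2 - p)
      then Real.rpow ((N : ℝ) / s) (1 - p)
      else 1 - ((s : ℝ) / N) * (1 - p) *
        Real.rpow (1 / (2 - p)) ((2 - p) / (1 - p))) * phiW p M w ≤
      phiW p M (fun i => (n i : ℝ)) := by
  have hp0 := hp.1
  have hp1 := hp.2
  have hcp : ∀ i, cpow (w i) (1 - p) = w i ^ (1 - p) := fun i => by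
    rw [cpow]
    split_ifs with h
    · rw [h, Real.zero_rpow (by linarith)]
    · rfl
  simp only [hcp, Real.rpow_eq_pow] at hnopt ⊢
  have hN' : (0 : ℝ) < N := by exact_mod_cast hN
  have hn0 : ∀ i, (0 : ℝ) ≤ n i := fun i => Nat.cast_nonneg _
  have hφ : 0 ≤ phiW p M w := phiW_nonneg hM hw0
  rcases hφ.eq_or_lt with hφ0 | hφ0
  · rw [← hφ0, mul_zero]
    exact phiW_nonneg hM hn0
  obtain ⟨c, hc, hcx⟩ := exists_phiW_tangent hp hM hw0
  have hscale : ∀ y : ℝ, 1 < y → N < y * ∑ i, w i := fun y hy => by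
    by_contra! hle
    have h := (hcx (fun _ => y) fun _ => by linarith).trans
      (hopt _ (fun i => mul_nonneg (by linarith) (hw0 i)) (by rwa [← Finset.mul_sum]))
    rw [← Finset.mul_sum, hc] at h
    nlinarith [Real.one_lt_rpow hy hp0]
  have hwpos : 0 < ∑ i, w i := by
    have := hscale 2 one_lt_two
    linarith
  have hwN' : ∑ i, w i = N := by
    refine hwN.antisymm ?_
    by_contra! hlt
    have h := hscale (N / ∑ i, w i) ((one_lt_div hwpos).2 hlt)
    rw [div_mul_cancel₀ _ hwpos.ne'] at h
    exact h.false
  obtain ⟨j, -, hj⟩ := Finset.exists_lt_of_sum_lt (f := fun _ => (0 : ℝ)) (g := w)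
    (s := Finset.univ) (by simpa using hwpos)
  have hsupp : ∀ i, w i = 0 → n i = 0 := fun i hi =>
    eq_zero_of_isMax_sum_rpow hp0 (fun i => Real.rpow_nonneg (hw0 i) (1 - p))
      (Real.rpow_pos_of_pos hj _) (fun n' hn' => hnopt n' (hn'.trans hn))
      (by rw [hi, Real.zero_rpow (by linarith)])
  have hxw : ∀ i, (n i : ℝ) / w i * w i = n i := fun i => by
    by_cases hi : w i = 0
    · simp [hi, hsupp i hi]
    · exact div_mul_cancel₀ _ hi
  have hbound := hcx (fun i => n i / w i) fun i => div_nonneg (hn0 i) (hw0 i)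
  simp only [hxw] at hbound
  obtain ⟨n', hn', hF⟩ := exists_rounding_of_le hp hN hw0 hwN'
  rw [Fintype.card_fin] at hF
  refine le_trans ?_ hbound
  calc _ ≤ (∑ i, (n i : ℝ) ^ p * w i ^ (1 - p)) / N * phiW p M w := by
        gcongr
        rw [le_div_iff₀ hN']
        exact hF.trans (hnopt n' hn')
    _ = ∑ i, (n i : ℝ) ^ p * w i ^ (1 - p) / N * phiW p M w := by
        rw [Finset.sum_div, Finset.sum_mul]
    _ ≤ _ := by
        refine Finset.sum_le_sum fun i _ => ?_
        rcases (hw0 i).eq_or_lt with hi | hi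
        · rw [← hi, Real.zero_rpow (by linarith), div_zero, Real.zero_rpow hp0.ne']; simp
        · have h := mul_le_tangent_coeff hp hN' hw0 hwN hopt hφ hc hcx hi
          calc _ = ((n i : ℝ) / w i) ^ p * (phiW p M w * (w i / N)) := by
                rw [Real.div_rpow (hn0 i) hi.le, Real.rpow_sub hi, Real.rpow_one]
                field_simp
            _ ≤ _ := by gcongr
end
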